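/- Let A be an arrangement, H ∈ A and A' := A \ {H}. Assume A' is free with exp(A') = (d_1,…,d_ℓ), d_1 ≤ … ≤ d_ℓ. If d := |A'| − |A^H| ≥ d_{ℓ−2}, then A is free, or strictly plus-one generated with POexp(A) = (d_1,…,d_{ℓ−2}, d_{ℓ−1}+1, d_ℓ+1) and level d_{ℓ−1} + d_ℓ − |A| + |A^H| + 1. -/

import Mathlib

open MvPolynomial

noncomputable section

attribute [local instance] Classical.propDecidable

namespace ArrPOG

variable (K : Type) [Field K] (ℓ : ℕ)

/-- A polynomial vector field on `K^ℓ`: `θ = Σ θᵢ ∂/∂xᵢ`, identified with its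
coefficient vector `(θ₁,…,θ_ℓ)` in `S = K[x₁,…,x_ℓ]`. -/
abbrev Deriv : Type := Fin ℓ → MvPolynomial (Fin ℓ) K

variable {K ℓ}

/-- The linear polynomial `α_H ∈ S` associated to a linear form `φ ∈ V*`. -/
def linPoly (φ : Module.Dual K (Fin ℓ → K)) : MvPolynomial (Fin ℓ) K :=
  ∑ i, MvPolynomial.C (φ (Pi.single i 1)) * MvPolynomial.X i

/-- `θ(α)` for a derivation `θ` and the linear form `α` given by `φ ∈ V*`. -/
def applyLin (θ : Deriv K ℓ) (φ : Module.Dual K (Fin ℓ → K)) : MvPolynomial (Fin ℓ) K :=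
  ∑ i, MvPolynomial.C (φ (Pi.single i 1)) * θ i

/-- An arrangement: a finite set of hyperplanes (kernels of nonzero linear forms). -/
def IsArrangement (A : Finset (Submodule K (Fin ℓ → K))) : Prop :=
  ∀ H ∈ A, ∃ φ : Module.Dual K (Fin ℓ → K), φ ≠ 0 ∧ LinearMap.ker φ = H

/-- Essential: the common intersection of all members is `0`. -/
def Essential (A : Finset (Submodule K (Fin ℓ → K))) : Prop :=
  A.inf id = ⊥

/-- Membership in the logarithmic derivation module `D(A)`:
`θ(α_H) ∈ S·α_H` for every `H ∈ A`. -/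
def InD (A : Finset (Submodule K (Fin ℓ → K))) (θ : Deriv K ℓ) : Prop :=
  ∀ H ∈ A, ∀ φ : Module.Dual K (Fin ℓ → K), LinearMap.ker φ = H → linPoly φ ∣ applyLin θ φ

/-- A derivation is homogeneous of degree `n` if all its coefficients are. -/
def HomogDeriv (θ : Deriv K ℓ) (n : ℕ) : Prop := ∀ i, (θ i).IsHomogeneous n

/-- `θ₁,…,θₙ` generate `D(A)` as an `S`-module. -/
def GeneratesD {n : ℕ} (A : Finset (Submodule K (Fin ℓ → K))) (θ : Fin n → Deriv K ℓ) : Prop :=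
  (∀ i, InD A (θ i)) ∧
    ∀ η, InD A η → ∃ c : Fin n → MvPolynomial (Fin ℓ) K, η = ∑ i, c i • θ i

/-- `S`-linear independence of a family of derivations. -/
def IndepD {n : ℕ} (θ : Fin n → Deriv K ℓ) : Prop :=
  ∀ c : Fin n → MvPolynomial (Fin ℓ) K, (∑ i, c i • θ i) = 0 → ∀ i, c i = 0

/-- `A` is free with exponents `e`: `D(A)` has a homogeneous basis of degrees `e i`. -/
def IsFreeExp (A : Finset (Submodule K (Fin ℓ → K))) (e : Fin ℓ → ℕ) : Prop :=
  ∃ θ : Fin ℓ → Deriv K ℓ, (∀ i, HomogDeriv (θ i) (e i)) ∧ GeneratesD A θ ∧ IndepD θ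

/-- `A` is free. -/
def IsFree (A : Finset (Submodule K (Fin ℓ → K))) : Prop := ∃ e, IsFreeExp A e

/-- `A` is plus-one generated with exponents `e`, level `lev`, realized by the minimal
homogeneous generators `θ₁,…,θ_ℓ, φ` whose unique syzygy is `Σ fᵢ•θᵢ + α•φ = 0`:
this encodes the minimal free resolution
`0 → S[-lev-1] → S[-lev] ⊕ (⊕ S[-eᵢ]) → D(A) → 0`. -/
def IsPOGWith (A : Finset (Submodule K (Fin ℓ → K))) (e : Fin ℓ → ℕ) (lev : ℕ)
    (θ : Fin ℓ → Deriv K ℓ) (φ : Deriv K ℓ)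
    (f : Fin ℓ → MvPolynomial (Fin ℓ) K) (α : MvPolynomial (Fin ℓ) K) : Prop :=
  (∀ i, InD A (θ i)) ∧ InD A φ ∧
  (∀ i, HomogDeriv (θ i) (e i)) ∧ HomogDeriv φ lev ∧
  (∀ η, InD A η → ∃ (c : Fin ℓ → MvPolynomial (Fin ℓ) K) (g : MvPolynomial (Fin ℓ) K),
      η = (∑ i, c i • θ i) + g • φ) ∧
  α.IsHomogeneous 1 ∧
  (∀ i, (f i).IsHomogeneous (lev + 1 - e i)) ∧
  (∀ i, MvPolynomial.constantCoeff (f i) = 0) ∧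
  ((∑ i, f i • θ i) + α • φ = 0) ∧
  (¬ (α = 0 ∧ ∀ i, f i = 0)) ∧
  (∀ (g : Fin ℓ → MvPolynomial (Fin ℓ) K) (h : MvPolynomial (Fin ℓ) K),
      ((∑ i, g i • θ i) + h • φ = 0) →
      ∃ q : MvPolynomial (Fin ℓ) K, (∀ i, g i = q * f i) ∧ h = q * α)

/-- Plus-one generated with exponents `e` and level `lev`. -/
def IsPOG (A : Finset (Submodule K (Fin ℓ → K))) (e : Fin ℓ → ℕ) (lev : ℕ) : Prop :=
  ∃ θ φ f α, IsPOGWith A e lev θ φ f α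

/-- Strictly plus-one generated: the level coefficient `α` is nonzero. -/
def IsSPOG (A : Finset (Submodule K (Fin ℓ → K))) (e : Fin ℓ → ℕ) (lev : ℕ) : Prop :=
  ∃ θ φ f α, IsPOGWith A e lev θ φ f α ∧ α ≠ 0

/-- The restriction `A^H = {L ⊓ H | L ∈ A \ {H}}`. -/
def restrict (A : Finset (Submodule K (Fin ℓ → K))) (H : Submodule K (Fin ℓ → K)) :
    Finset (Submodule K (Fin ℓ → K)) :=
  (A.erase H).image (fun L => L ⊓ H)

/-- The localization `A_X = {L ∈ A | X ⊆ L}`. -/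
def localize (A : Finset (Submodule K (Fin ℓ → K))) (X : Submodule K (Fin ℓ → K)) :
    Finset (Submodule K (Fin ℓ → K)) :=
  A.filter (fun L => X ≤ L)

/-- The intersection lattice of `A`, inside the ambient space `T`. -/
def latticeOf (T : Submodule K (Fin ℓ → K)) (A : Finset (Submodule K (Fin ℓ → K))) :
    Finset (Submodule K (Fin ℓ → K)) :=
  A.powerset.image (fun B => T ⊓ B.inf id)

/-- The Möbius function of the poset `L` (intersection lattice with top `T`). -/
def mob (T : Submodule K (Fin ℓ → K)) (L : Finset (Submodule K (Fin ℓ → K)))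
    (X : Submodule K (Fin ℓ → K)) : ℤ :=
  if X = T then 1
  else - ∑ Y ∈ (L.filter fun Z => X < Z).attach, mob T L Y.1
termination_by (L.filter fun Z => X < Z).card
decreasing_by
  obtain ⟨Y, hY⟩ := Y
  simp only [Finset.mem_filter] at hY
  apply Finset.card_lt_card
  rw [Finset.ssubset_def]
  constructor
  · intro Z hZ
    simp only [Finset.mem_filter] at hZ ⊢
    exact ⟨hZ.1, lt_trans hY.2 hZ.2⟩
  · intro hsub
    have h2 := hsub (Finset.mem_filter.mpr ⟨hY.1, hY.2⟩)
    simp only [Finset.mem_filter] at h2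
    exact lt_irrefl Y h2.2

/-- The characteristic polynomial `χ(A;t) = Σ_{X ∈ L(A)} μ(X) t^{dim X}`
of an arrangement inside the ambient space `T`. -/
def charPoly (T : Submodule K (Fin ℓ → K)) (A : Finset (Submodule K (Fin ℓ → K))) :
    Polynomial ℤ :=
  ∑ X ∈ latticeOf T A,
    Polynomial.C (mob T (latticeOf T A) X) * Polynomial.X ^ (Module.finrank K X)

/-- The Betti number `b_i(A)`: `χ(A;t) = Σ (-1)^i b_i(A) t^{ℓ-i}`. -/
def bNum (A : Finset (Submodule K (Fin ℓ → K))) (i : ℕ) : ℤ :=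
  (-1) ^ i * (charPoly (⊤ : Submodule K (Fin ℓ → K)) A).coeff (ℓ - i)

/-- Evaluation of the Poincaré polynomial `π(A;t) = Σ μ(X) (-t)^{codim X}` at `t : ℚ`. -/
def poincareEval (A : Finset (Submodule K (Fin ℓ → K))) (t : ℚ) : ℚ :=
  ∑ X ∈ latticeOf ⊤ A,
    (mob (⊤ : Submodule K (Fin ℓ → K)) (latticeOf ⊤ A) X : ℚ) *
      (-t) ^ (ℓ - Module.finrank K X)

/-- The Euler derivation `θ_E = Σ xᵢ ∂/∂xᵢ`. -/
def eulerD : Deriv K ℓ := fun i => MvPolynomial.X i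

/-- `A` is locally free: `A_X` is free for every `X ∈ L(A)` other than `∩_{H∈A} H`. -/
def LocallyFree (A : Finset (Submodule K (Fin ℓ → K))) : Prop :=
  ∀ X ∈ latticeOf ⊤ A, X ≠ A.inf id → IsFree (localize A X)

/-- Transport a finite set of subspaces contained in `T` to `K^m` along a linear
isomorphism `T ≃ K^m`. -/
def transport {m : ℕ} (T : Submodule K (Fin ℓ → K)) (eqv : T ≃ₗ[K] (Fin m → K))
    (A : Finset (Submodule K (Fin ℓ → K))) : Finset (Submodule K (Fin m → K)) :=
  A.image fun L => (L.comap T.subtype).map eqv.toLinearMap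

/-- An arrangement inside the subspace `T` is free with exponents `e`, i.e. it is free
after identifying `T` with a coordinate space. -/
def RestrFreeExp {m : ℕ} (T : Submodule K (Fin ℓ → K))
    (A : Finset (Submodule K (Fin ℓ → K))) (e : Fin m → ℕ) : Prop :=
  ∃ eqv : T ≃ₗ[K] (Fin m → K), IsFreeExp (transport T eqv A) e

/-- The multiset of exponents. -/
def expMS {n : ℕ} (e : Fin n → ℕ) : Multiset ℕ := Finset.univ.val.map e

/-- `D(A)` has projective dimension at most 1: some finite generating set has a free
(possibly zero) syzygy module, i.e. there is a free resolution
`0 → S^m → S^n → D(A) → 0`. -/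
def PdimLEOne (A : Finset (Submodule K (Fin ℓ → K))) : Prop :=
  ∃ (n m : ℕ) (θ : Fin n → Deriv K ℓ) (r : Fin m → Fin n → MvPolynomial (Fin ℓ) K),
    GeneratesD A θ ∧
    (∀ j, (∑ i, r j i • θ i) = 0) ∧
    (∀ c : Fin n → MvPolynomial (Fin ℓ) K, (∑ i, c i • θ i) = 0 →
      ∃ q : Fin m → MvPolynomial (Fin ℓ) K, ∀ i, c i = ∑ j, q j * r j i) ∧
    (∀ q : Fin m → MvPolynomial (Fin ℓ) K, (∀ i, (∑ j, q j * r j i) = 0) → ∀ j, q j = 0)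

/-- `A` has a free filtration `∅ = A₀ ⊂ A₁ ⊂ ⋯ ⊂ A_n = A`, `|A_i| = i`, each `A_i` free. -/
def HasFreeFiltration (A : Finset (Submodule K (Fin ℓ → K))) : Prop :=
  ∃ c : ℕ → Finset (Submodule K (Fin ℓ → K)),
    c A.card = A ∧ (∀ i ≤ A.card, (c i).card = i ∧ IsFree (c i)) ∧
    ∀ i < A.card, c i ⊆ c (i + 1)

/-- The intersection lattices of `A` and `B` are isomorphic: there is a bijection of
hyperplanes preserving the rank of every subset (equivalently, a lattice isomorphism). -/
def LatticeEquiv (A B : Finset (Submodule K (Fin ℓ → K))) : Prop :=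
  ∃ σ : Submodule K (Fin ℓ → K) → Submodule K (Fin ℓ → K),
    Set.BijOn σ ↑A ↑B ∧
    ∀ T ⊆ A, Module.finrank K ((T.inf id : Submodule K (Fin ℓ → K))) =
      Module.finrank K (((T.image σ).inf id : Submodule K (Fin ℓ → K)))


/-! ### Basic facts on linear forms -/

lemma linPoly_hom (φ : Module.Dual K (Fin ℓ → K)) : (linPoly φ).IsHomogeneous 1 := by
  unfold linPoly
  exact IsHomogeneous.sum _ _ _ fun i _ => isHomogeneous_C_mul_X _ _

lemma dual_apply (φ : Module.Dual K (Fin ℓ → K)) (x : Fin ℓ → K) :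
    φ x = ∑ i, φ (Pi.single i 1) * x i := by
  conv_lhs => rw [pi_eq_sum_univ' x]
  rw [map_sum]
  refine Finset.sum_congr rfl fun i _ => ?_
  rw [map_smul, smul_eq_mul, mul_comm]

lemma eval_linPoly (φ : Module.Dual K (Fin ℓ → K)) (x : Fin ℓ → K) :
    MvPolynomial.eval x (linPoly φ) = φ x := by
  rw [dual_apply]; simp [linPoly]

lemma linPoly_add (φ ψ : Module.Dual K (Fin ℓ → K)) :
    linPoly (φ + ψ) = linPoly φ + linPoly ψ := by
  simp [linPoly, add_mul, Finset.sum_add_distrib]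

lemma linPoly_smul (c : K) (φ : Module.Dual K (Fin ℓ → K)) :
    linPoly (c • φ) = C c * linPoly φ := by
  simp [linPoly, Finset.mul_sum, mul_assoc]

lemma applyLin_add (θ : Deriv K ℓ) (φ ψ : Module.Dual K (Fin ℓ → K)) :
    applyLin θ (φ + ψ) = applyLin θ φ + applyLin θ ψ := by
  simp [applyLin, add_mul, Finset.sum_add_distrib]

lemma applyLin_smul (c : K) (θ : Deriv K ℓ) (φ : Module.Dual K (Fin ℓ → K)) :
    applyLin θ (c • φ) = C c * applyLin θ φ := by
  simp [applyLin, Finset.mul_sum, mul_assoc]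

lemma applyLin_sum {n : ℕ} (θ : Fin n → Deriv K ℓ) (c : Fin n → MvPolynomial (Fin ℓ) K)
    (φ : Module.Dual K (Fin ℓ → K)) :
    applyLin (∑ i, c i • θ i) φ = ∑ i, c i * applyLin (θ i) φ := by
  simp only [applyLin, Finset.sum_apply, Pi.smul_apply, smul_eq_mul, Finset.mul_sum]
  rw [Finset.sum_comm]
  exact Finset.sum_congr rfl fun i _ => Finset.sum_congr rfl fun j _ => by ring

lemma applyLin_hom {θ : Deriv K ℓ} {n : ℕ} (h : HomogDeriv θ n)
    (φ : Module.Dual K (Fin ℓ → K)) : (applyLin θ φ).IsHomogeneous n :=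
  IsHomogeneous.sum _ _ _ fun i _ => (h i).C_mul _

lemma applyLin_const (P : MvPolynomial (Fin ℓ) K) (w : Fin ℓ → K)
    (φ : Module.Dual K (Fin ℓ → K)) :
    applyLin (fun i => P * C (w i)) φ = P * C (φ w) := by
  rw [dual_apply φ w]
  simp only [applyLin, map_sum, Finset.mul_sum, map_mul]
  exact Finset.sum_congr rfl fun i _ => by ring

lemma linPoly_ne_zero {φ : Module.Dual K (Fin ℓ → K)} (h : φ ≠ 0) : linPoly φ ≠ 0 := by
  intro h0
  apply h
  refine LinearMap.ext fun x => ?_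
  rw [← eval_linPoly, h0]; simp

lemma ker_le_ker_exists {φ ψ : Module.Dual K (Fin ℓ → K)}
    (h : LinearMap.ker φ ≤ LinearMap.ker ψ) : ∃ t : K, ψ = t • φ := by
  have := mem_span_of_iInf_ker_le_ker (ι := Unit) (L := fun _ => φ) (K := ψ) (by simpa using h)
  simp only [Set.range_const, Submodule.mem_span_singleton] at this
  obtain ⟨t, ht⟩ := this
  exact ⟨t, ht.symm⟩

lemma linPoly_irred {φ : Module.Dual K (Fin ℓ → K)} (h : φ ≠ 0) : Irreducible (linPoly φ) := by
  apply irreducible_of_totalDegree_eq_one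
  · exact (linPoly_hom φ).totalDegree (linPoly_ne_zero h)
  · intro x hx
    by_contra hu
    have hx0 : x = 0 := by
      by_contra h1
      exact hu (isUnit_iff_ne_zero.mpr h1)
    subst hx0
    apply linPoly_ne_zero h
    ext m
    simpa using hx m

lemma linPoly_relPrime {φ ψ : Module.Dual K (Fin ℓ → K)} (h : φ ≠ 0) (h' : ψ ≠ 0)
    (hk : LinearMap.ker φ ≠ LinearMap.ker ψ) : IsRelPrime (linPoly φ) (linPoly ψ) := by
  rcases (linPoly_irred h).dvd_or_isRelPrime (n := linPoly ψ) with h1 | h1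
  · exfalso
    have hle : LinearMap.ker φ ≤ LinearMap.ker ψ := by
      intro x hx
      obtain ⟨q, hq⟩ := h1
      rw [LinearMap.mem_ker] at hx ⊢
      rw [← eval_linPoly, hq, map_mul, eval_linPoly, hx, zero_mul]
    obtain ⟨t, rfl⟩ := ker_le_ker_exists hle
    have ht : t ≠ 0 := by rintro rfl; simp at h'
    exact hk (LinearMap.ker_smul _ _ ht).symm
  · exact h1

/-! ### The projection along `v` -/

/-- The substitution `x ↦ x - α(x) v`. -/
def proj (a : Module.Dual K (Fin ℓ → K)) (v : Fin ℓ → K) :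
    MvPolynomial (Fin ℓ) K →ₐ[K] MvPolynomial (Fin ℓ) K :=
  MvPolynomial.aeval fun i => X i - C (v i) * linPoly a

lemma proj_hom (a : Module.Dual K (Fin ℓ → K)) (v : Fin ℓ → K) {p : MvPolynomial (Fin ℓ) K}
    {n : ℕ} (hp : p.IsHomogeneous n) : (proj a v p).IsHomogeneous n := by
  have := hp.aeval (fun i => X i - C (v i) * linPoly a)
    (fun i => (isHomogeneous_X K i).sub ((linPoly_hom a).C_mul (v i)))
  rw [one_mul] at this
  exact this

lemma proj_C (a : Module.Dual K (Fin ℓ → K)) (v : Fin ℓ → K) (c : K) :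
    proj a v (C c) = C c := by
  simp [proj]

lemma proj_linPoly (a : Module.Dual K (Fin ℓ → K)) (v : Fin ℓ → K)
    (φ : Module.Dual K (Fin ℓ → K)) :
    proj a v (linPoly φ) = linPoly φ - C (φ v) * linPoly a := by
  rw [dual_apply φ v]
  simp only [linPoly, proj, map_sum, map_mul, aeval_X, mul_sub, Finset.sum_sub_distrib,
    algHom_C, algebraMap_eq, Finset.sum_mul, mul_assoc]

lemma dvd_sub_proj (a : Module.Dual K (Fin ℓ → K)) (v : Fin ℓ → K) (p : MvPolynomial (Fin ℓ) K) :
    linPoly a ∣ p - proj a v p := by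
  induction p using MvPolynomial.induction_on with
  | C c => simp
  | add p q hp hq =>
    rw [map_add, add_sub_add_comm]
    exact dvd_add hp hq
  | mul_X p i hp =>
    have : p * X i - proj a v (p * X i) = (p - proj a v p) * X i
        + linPoly a * (proj a v p * C (v i)) := by
      rw [map_mul]
      have : proj a v (X i) = X i - C (v i) * linPoly a := by simp [proj]
      rw [this]; ring
    rw [this]
    exact dvd_add (hp.mul_right _) (dvd_mul_right _ _)

lemma proj_self {a : Module.Dual K (Fin ℓ → K)} {v : Fin ℓ → K} (hv : a v = 1) :
    proj a v (linPoly a) = 0 := by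
  rw [proj_linPoly, hv]; simp

lemma proj_eq_zero_iff {a : Module.Dual K (Fin ℓ → K)} {v : Fin ℓ → K} (hv : a v = 1)
    (p : MvPolynomial (Fin ℓ) K) : proj a v p = 0 ↔ linPoly a ∣ p := by
  constructor
  · intro h
    have := dvd_sub_proj a v p
    rwa [h, sub_zero] at this
  · rintro ⟨q, rfl⟩
    rw [map_mul, proj_self hv, zero_mul]

lemma proj_proj {a : Module.Dual K (Fin ℓ → K)} {v : Fin ℓ → K} (hv : a v = 1)
    (p : MvPolynomial (Fin ℓ) K) : proj a v (proj a v p) = proj a v p := by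
  have := (proj_eq_zero_iff hv _).mpr (dvd_sub_proj a v p)
  rw [map_sub, sub_eq_zero] at this
  exact this.symm

/-- A cofactor of a homogeneous polynomial in a homogeneous polynomial is homogeneous. -/
lemma cofactor_hom {B b : MvPolynomial (Fin ℓ) K} {d n : ℕ} (hB : B.IsHomogeneous d)
    (hB0 : B ≠ 0) (h : (B * b).IsHomogeneous n) (hb : b ≠ 0) :
    d ≤ n ∧ b.IsHomogeneous (n - d) := by
  have key : ∀ m, homogeneousComponent m b ≠ 0 → n = d + m := by
    intro m hm
    have h1 : homogeneousComponent (d + m) (B * b) = B * homogeneousComponent m b := by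
      conv_lhs => rw [← sum_homogeneousComponent b, Finset.mul_sum, map_sum]
      have : ∀ i, homogeneousComponent (d + m) (B * homogeneousComponent i b)
          = if i = m then B * homogeneousComponent m b else 0 := by
        intro i
        rw [homogeneousComponent_of_mem (hB.mul (homogeneousComponent_isHomogeneous i b))]
        by_cases him : i = m
        · subst him; simp
        · rw [if_neg (by omega), if_neg him]
      simp only [this]
      rw [Finset.sum_ite_eq', if_pos]
      rw [Finset.mem_range]
      by_contra hlt
      exact hm (homogeneousComponent_eq_zero _ _ (by omega))
    rw [homogeneousComponent_of_mem h] at h1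
    by_contra hne
    rw [if_neg (Ne.symm hne)] at h1
    exact (mul_ne_zero hB0 hm) h1.symm
  obtain ⟨m, hm⟩ : ∃ m, homogeneousComponent m b ≠ 0 := by
    by_contra hcon
    push Not at hcon
    apply hb
    rw [← sum_homogeneousComponent b]
    exact Finset.sum_eq_zero fun i _ => hcon i
  have hn := key m hm
  refine ⟨by omega, ?_⟩
  have : b = homogeneousComponent m b := by
    conv_lhs => rw [← sum_homogeneousComponent b]
    rw [Finset.sum_eq_single m]
    · intro i _ him
      by_contra hi
      have := key i hi
      omega
    · intro hr
      rw [Finset.mem_range] at hr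
      exact homogeneousComponent_eq_zero _ _ (by omega)
  rw [this, show n - d = m by omega]
  exact homogeneousComponent_isHomogeneous m b

/-! ### Terao's polynomial -/

lemma inD_of {A : Finset (Submodule K (Fin ℓ → K))} {θ : Deriv K ℓ}
    (ψ : Submodule K (Fin ℓ → K) → Module.Dual K (Fin ℓ → K))
    (hψ : ∀ L ∈ A, LinearMap.ker (ψ L) = L)
    (h : ∀ L ∈ A, linPoly (ψ L) ∣ applyLin θ (ψ L)) : InD A θ := by
  intro L hL φ hφ
  obtain ⟨t, rfl⟩ := ker_le_ker_exists (φ := ψ L) (ψ := φ) (by rw [hφ, hψ L hL])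
  rw [linPoly_smul, applyLin_smul]
  exact mul_dvd_mul_left _ (h L hL)

lemma exists_data {A : Finset (Submodule K (Fin ℓ → K))} (hA : IsArrangement A)
    {H : Submodule K (Fin ℓ → K)} (hH : H ∈ A) :
    ∃ (a : Module.Dual K (Fin ℓ → K)) (v : Fin ℓ → K)
      (β : Submodule K (Fin ℓ → K) → Module.Dual K (Fin ℓ → K))
      (c : Submodule K (Fin ℓ → K) → K),
      LinearMap.ker a = H ∧ a v = 1 ∧
      (∀ L ∈ A.erase H, LinearMap.ker (β (L ⊓ H) + c L • a) = L) ∧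
      ∀ X ∈ restrict A H, β X v = 0 ∧ β X ≠ 0 ∧ X = LinearMap.ker (β X) ⊓ H := by
  obtain ⟨a, ha0, haH⟩ := hA H hH
  obtain ⟨u, hu⟩ : ∃ u, a u ≠ 0 := by
    by_contra hcon
    push Not at hcon
    exact ha0 (LinearMap.ext hcon)
  obtain ⟨v, hv⟩ : ∃ v, a v = 1 := ⟨(a u)⁻¹ • u, by simp [hu]⟩
  have memH : ∀ x, x ∈ H ↔ a x = 0 := fun x => by rw [← haH, LinearMap.mem_ker]
  have key : ∀ X ∈ restrict A H, ∃ b : Module.Dual K (Fin ℓ → K),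
      b v = 0 ∧ b ≠ 0 ∧ X = LinearMap.ker b ⊓ H ∧
      ∀ L ∈ A.erase H, L ⊓ H = X → ∃ c : K, LinearMap.ker (b + c • a) = L := by
    intro X hX
    obtain ⟨L0, hL0, rfl⟩ := Finset.mem_image.mp hX
    obtain ⟨hne0, hL0A⟩ := Finset.mem_erase.mp hL0
    -- a nonzero form not proportional to `a` stays nonzero after projection
    have nz : ∀ L ∈ A.erase H, ∀ φ : Module.Dual K (Fin ℓ → K), φ ≠ 0 → LinearMap.ker φ = L →
        φ - φ v • a ≠ 0 := by
      intro L hL φ hφ hk h0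
      rw [sub_eq_zero] at h0
      have ht : φ v ≠ 0 := by
        intro h1; rw [h1, zero_smul] at h0; exact hφ h0
      apply (Finset.mem_erase.mp hL).1
      rw [← hk, h0, LinearMap.ker_smul _ _ ht, haH]
    obtain ⟨φ0, hφ0, hk0⟩ := hA L0 hL0A
    refine ⟨φ0 - φ0 v • a, by simp [hv], nz L0 hL0 φ0 hφ0 hk0, ?_, ?_⟩
    · ext x
      simp only [Submodule.mem_inf, memH, ← hk0, LinearMap.mem_ker, LinearMap.sub_apply,
        LinearMap.smul_apply, smul_eq_mul]
      constructor
      · rintro ⟨h1, h2⟩; simp [h1, h2]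
      · rintro ⟨h1, h2⟩; rw [h2, mul_zero, sub_zero] at h1; exact ⟨h1, h2⟩
    · intro L hL hLX
      obtain ⟨φ, hφ, hk⟩ := hA L (Finset.mem_erase.mp hL).2
      have hle : LinearMap.ker (φ0 - φ0 v • a) ≤ LinearMap.ker (φ - φ v • a) := by
        intro x hx
        have hx' : φ0 x - φ0 v * a x = 0 := by simpa using hx
        have h1 : x - a x • v ∈ L0 ⊓ H := by
          rw [Submodule.mem_inf, memH, ← hk0, LinearMap.mem_ker]
          constructor
          · rw [map_sub, map_smul, smul_eq_mul, mul_comm]; exact hx'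
          · simp [hv]
        rw [← hLX, Submodule.mem_inf, ← hk, LinearMap.mem_ker] at h1
        have h2 := h1.1
        rw [map_sub, map_smul, smul_eq_mul, mul_comm] at h2
        simpa using h2
      obtain ⟨t, ht⟩ := ker_le_ker_exists hle
      have ht0 : t ≠ 0 := by
        rintro rfl
        rw [zero_smul] at ht
        exact nz L hL φ hφ hk ht
      refine ⟨t⁻¹ * φ v, ?_⟩
      rw [← hk, ← LinearMap.ker_smul (φ0 - φ0 v • a + (t⁻¹ * φ v) • a) t ht0]
      congr 1
      rw [smul_add, ← ht, smul_smul, ← mul_assoc, mul_inv_cancel₀ ht0, one_mul]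
      abel
  choose! β hβ using key
  have hc : ∀ L ∈ A.erase H, ∃ c : K, LinearMap.ker (β (L ⊓ H) + c • a) = L := fun L hL =>
    (hβ (L ⊓ H) (Finset.mem_image_of_mem _ hL)).2.2.2 L hL rfl
  choose! c hc using hc
  exact ⟨a, v, β, c, haH, hv, hc, fun X hX => ⟨(hβ X hX).1, (hβ X hX).2.1, (hβ X hX).2.2.1⟩⟩

lemma terao {A : Finset (Submodule K (Fin ℓ → K))} (hA : IsArrangement A)
    {H : Submodule K (Fin ℓ → K)} (hH : H ∈ A) :
    ∃ (a : Module.Dual K (Fin ℓ → K)) (v : Fin ℓ → K) (B : MvPolynomial (Fin ℓ) K) (d : ℕ),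
      LinearMap.ker a = H ∧ a v = 1 ∧ B.IsHomogeneous d ∧ B ≠ 0 ∧ proj a v B = B ∧
      d + (restrict A H).card = (A.erase H).card ∧
      (∀ θ, InD (A.erase H) θ → B ∣ proj a v (applyLin θ a)) ∧
      ∀ g, Prime g → ¬ ∀ θ, InD (A.erase H) θ → B * g ∣ proj a v (applyLin θ a) := by
  obtain ⟨a, v, β, c, haH, hv, hc, hβ⟩ := exists_data hA hH
  set A' := A.erase H with hA'
  set T := restrict A H with hT
  set k : Submodule K (Fin ℓ → K) → ℕ := fun X => (A'.filter fun L => L ⊓ H = X).card with hk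
  set ψ : Submodule K (Fin ℓ → K) → Module.Dual K (Fin ℓ → K) :=
    fun L => β (L ⊓ H) + c L • a with hψ
  have memT : ∀ L ∈ A', L ⊓ H ∈ T := fun L hL => Finset.mem_image_of_mem _ hL
  have hkpos : ∀ X ∈ T, 1 ≤ k X := by
    intro X hX
    obtain ⟨L, hL, rfl⟩ := Finset.mem_image.mp hX
    exact Finset.card_pos.mpr ⟨L, Finset.mem_filter.mpr ⟨hL, rfl⟩⟩
  have hksum : ∑ X ∈ T, k X = A'.card := by
    rw [Finset.card_eq_sum_card_fiberwise (f := fun L => L ⊓ H) (t := T)]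
    intro L hL
    exact memT L hL
  have projβ : ∀ X ∈ T, proj a v (linPoly (β X)) = linPoly (β X) := by
    intro X hX
    rw [proj_linPoly, (hβ X hX).1]; simp
  have projψ : ∀ L ∈ A', proj a v (linPoly (ψ L)) = linPoly (β (L ⊓ H)) := by
    intro L hL
    have h1 := projβ _ (memT L hL)
    simp only [hψ]
    rw [linPoly_add, linPoly_smul, map_add, map_mul, h1, proj_self hv, mul_zero, add_zero]
  have relβ : (T : Set (Submodule K (Fin ℓ → K))).Pairwise
      (Function.onFun IsRelPrime fun X => linPoly (β X)) := by
    intro X hX Y hY hXY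
    refine linPoly_relPrime (hβ X hX).2.1 (hβ Y hY).2.1 fun he => hXY ?_
    rw [(hβ X hX).2.2, (hβ Y hY).2.2, he]
  have ψne : ∀ L ∈ A', ψ L ≠ 0 := by
    intro L hL h0
    obtain ⟨φ, hφ, hkφ⟩ := hA L (Finset.mem_erase.mp hL).2
    have h1 := hc L hL
    change LinearMap.ker (ψ L) = L at h1
    rw [h0, LinearMap.ker_zero] at h1
    exact hφ (LinearMap.ker_eq_top.mp (by rw [hkφ, ← h1]))
  have relψ : (A' : Set (Submodule K (Fin ℓ → K))).Pairwise
      (Function.onFun IsRelPrime fun L => linPoly (ψ L)) := by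
    intro L hL M hM hLM
    refine linPoly_relPrime (ψne L hL) (ψne M hM) fun he => hLM ?_
    rw [← hc L hL, ← hc M hM]; exact he
  set B := ∏ X ∈ T, linPoly (β X) ^ (k X - 1) with hB
  set P := ∏ X ∈ T, linPoly (β X) with hP
  set Q := ∏ L ∈ A', linPoly (ψ L) with hQ
  have hB0 : B ≠ 0 := Finset.prod_ne_zero_iff.mpr fun X hX =>
    pow_ne_zero _ (linPoly_ne_zero (hβ X hX).2.1)
  have projQ : proj a v Q = B * P := by
    rw [hQ, map_prod, Finset.prod_congr rfl projψ,
      Finset.prod_comp (fun X => linPoly (β X)) (fun L => L ⊓ H), hB, hP,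
      ← Finset.prod_mul_distrib]
    refine Finset.prod_congr rfl fun X hX => ?_
    rw [← pow_succ, Nat.sub_add_cancel (hkpos X hX)]
  refine ⟨a, v, B, ∑ X ∈ T, (k X - 1), haH, hv, ?_, hB0, ?_, ?_, ?_, ?_⟩
  · refine IsHomogeneous.prod _ _ _ fun X hX => ?_
    simpa using (linPoly_hom (β X)).pow (k X - 1)
  · rw [hB, map_prod]
    refine Finset.prod_congr rfl fun X hX => ?_
    rw [map_pow, projβ X hX]
  · rw [← hksum, Finset.card_eq_sum_ones, ← Finset.sum_add_distrib]
    exact Finset.sum_congr rfl fun X hX => Nat.sub_add_cancel (hkpos X hX)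
  · intro θ hθ
    refine Finset.prod_dvd_of_isRelPrime ?_ ?_
    · intro X hX Y hY hXY
      exact (relβ hX hY hXY).pow
    · intro X hX
      have hW : ∏ L ∈ A'.filter (fun L => L ⊓ H = X), linPoly (ψ L) ∣
          applyLin θ a * linPoly (β X) - applyLin θ (β X) * linPoly a := by
        refine Finset.prod_dvd_of_isRelPrime ?_ ?_
        · exact relψ.mono fun L hL => (Finset.mem_filter.mp hL).1
        · intro L hL
          obtain ⟨hL, hLX⟩ := Finset.mem_filter.mp hL
          have h1 : linPoly (ψ L) ∣ applyLin θ (ψ L) := hθ L hL _ (hc L hL)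
          have h2 : linPoly (ψ L) = linPoly (β X) + C (c L) * linPoly a := by
            simp only [hψ]; rw [hLX, linPoly_add, linPoly_smul]
          have h3 : applyLin θ (ψ L) = applyLin θ (β X) + C (c L) * applyLin θ a := by
            simp only [hψ]; rw [hLX, applyLin_add, applyLin_smul]
          have : applyLin θ a * linPoly (β X) - applyLin θ (β X) * linPoly a =
              applyLin θ a * linPoly (ψ L) - applyLin θ (ψ L) * linPoly a := by
            rw [h2, h3]; ring
          rw [this]
          exact dvd_sub (dvd_mul_left _ _) (h1.mul_right _)
      have h4 := map_dvd (proj a v) hW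
      rw [map_sub, map_mul, map_mul _ _ (linPoly a), proj_self hv, mul_zero, sub_zero,
        projβ X hX, map_prod] at h4
      have h5 : ∏ L ∈ A'.filter (fun L => L ⊓ H = X), proj a v (linPoly (ψ L))
          = linPoly (β X) ^ k X := by
        rw [hk, ← Finset.prod_const]
        refine Finset.prod_congr rfl fun L hL => ?_
        obtain ⟨hL, hLX⟩ := Finset.mem_filter.mp hL
        rw [projψ L hL, hLX]
      rw [h5, ← Nat.sub_add_cancel (hkpos X hX), pow_succ] at h4
      exact (mul_dvd_mul_iff_right (linPoly_ne_zero (hβ X hX).2.1)).mp h4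
  · intro g hg hall
    -- first: `g` divides `P`
    have hgP : g ∣ P := by
      have h1 : InD A' (fun i => Q * C (v i)) := by
        refine inD_of ψ hc fun L hL => ?_
        rw [applyLin_const]
        exact (Finset.dvd_prod_of_mem _ hL).mul_right _
      have h2 := hall _ h1
      rw [applyLin_const, hv, map_one, mul_one, projQ] at h2
      exact (mul_dvd_mul_iff_left hB0).mp h2
    obtain ⟨X0, hX0, hgX0⟩ := hg.exists_mem_finset_dvd hgP
    obtain ⟨L0, hL0, hL0X⟩ := Finset.mem_image.mp hX0
    have hgP' : g ∣ ∏ X ∈ T.erase X0, linPoly (β X) := by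
      obtain ⟨w, hw1, hw2⟩ : ∃ w, ψ L0 w = 0 ∧ a w = 1 := by
        obtain ⟨u, hu⟩ : ∃ u, β X0 u ≠ 0 := by
          by_contra hcon
          push Not at hcon
          exact (hβ X0 hX0).2.1 (LinearMap.ext hcon)
        have hb0 := (hβ X0 hX0).1
        refine ⟨v - (c L0 * (β X0 u)⁻¹) • (u - a u • v), ?_, ?_⟩
        · simp only [hψ, hL0X, LinearMap.add_apply, LinearMap.smul_apply, map_sub, map_smul,
            smul_eq_mul, hb0, hv]
          field_simp
          ring
        · simp [hv]
      set R := ∏ L ∈ A'.erase L0, linPoly (ψ L) with hR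
      have hQR : Q = linPoly (ψ L0) * R := (Finset.mul_prod_erase _ _ hL0).symm
      have hPR : P = linPoly (β X0) * ∏ X ∈ T.erase X0, linPoly (β X) :=
        (Finset.mul_prod_erase _ _ hX0).symm
      have h1 : InD A' (fun i => R * C (w i)) := by
        refine inD_of ψ hc fun L hL => ?_
        rw [applyLin_const]
        by_cases hLL : L = L0
        · subst hLL
          rw [hw1]; simp
        · exact (Finset.dvd_prod_of_mem (fun L => linPoly (ψ L))
            (Finset.mem_erase.mpr ⟨hLL, hL⟩)).mul_right _
      have h2 := hall _ h1
      rw [applyLin_const, hw2, map_one, mul_one] at h2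
      have h3 : proj a v R = B * ∏ X ∈ T.erase X0, linPoly (β X) := by
        have h4 := projQ
        rw [hQR, map_mul, projψ L0 hL0, hL0X, hPR, mul_left_comm] at h4
        exact mul_left_cancel₀ (linPoly_ne_zero (hβ X0 hX0).2.1) h4
      rw [h3] at h2
      exact (mul_dvd_mul_iff_left hB0).mp h2
    obtain ⟨X1, hX1, hgX1⟩ := hg.exists_mem_finset_dvd hgP'
    obtain ⟨hne, hX1⟩ := Finset.mem_erase.mp hX1
    exact hg.not_isUnit (relβ hX1 hX0 hne hgX1 hgX0)

/-- `D(A)` as a submodule. -/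
def Dmod (A : Finset (Submodule K (Fin ℓ → K))) :
    Submodule (MvPolynomial (Fin ℓ) K) (Deriv K ℓ) where
  carrier := {θ | InD A θ}
  add_mem' := by
    intro x y hx hy L hL φ hφ
    have : applyLin (x + y) φ = applyLin x φ + applyLin y φ := by
      simp [applyLin, mul_add, Finset.sum_add_distrib]
    rw [this]
    exact dvd_add (hx L hL φ hφ) (hy L hL φ hφ)
  zero_mem' := by
    intro L hL φ hφ
    simp [applyLin]
  smul_mem' := by
    intro c x hx L hL φ hφ
    have : applyLin (c • x) φ = c * applyLin x φ := by
      simp only [applyLin, Pi.smul_apply, smul_eq_mul, Finset.mul_sum]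
      exact Finset.sum_congr rfl fun i _ => by ring
    rw [this]
    exact (hx L hL φ hφ).mul_left _

lemma inD_iff {A : Finset (Submodule K (Fin ℓ → K))} {H : Submodule K (Fin ℓ → K)} (hH : H ∈ A)
    {a : Module.Dual K (Fin ℓ → K)} (ha : LinearMap.ker a = H) {η : Deriv K ℓ} :
    InD A η ↔ InD (A.erase H) η ∧ linPoly a ∣ applyLin η a := by
  constructor
  · intro h
    exact ⟨fun L hL => h L (Finset.mem_of_mem_erase hL), h H hH a ha⟩
  · rintro ⟨h1, h2⟩ L hL φ hφ
    by_cases hLH : L = H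
    · obtain ⟨t, rfl⟩ := ker_le_ker_exists (φ := a) (ψ := φ) (by rw [hφ, ha, hLH])
      rw [linPoly_smul, applyLin_smul]
      exact mul_dvd_mul_left _ h2
    · exact h1 L (Finset.mem_erase.mpr ⟨hLH, hL⟩) φ hφ

/-- Theorem `ell1`: suppose `A' = A \ {H}` is free with
`exp(A') = (d₁,…,d_ℓ)` increasing, and `d := |A'| - |A^H| ≥ d_{ℓ-2}`. Then `A` is free,
or strictly plus-one generated with `POexp(A) = (d₁,…,d_{ℓ-2}, d_{ℓ-1}+1, d_ℓ+1)` and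
level `d_{ℓ-1} + d_ℓ - |A| + |A^H| + 1`. -/
theorem addition_free_or_SPOG {K : Type} [Field K] {ℓ : ℕ} (hl : 3 ≤ ℓ)
    (A : Finset (Submodule K (Fin ℓ → K)))
    (hA : IsArrangement A) (hEss : Essential A)
    (H : Submodule K (Fin ℓ → K)) (hH : H ∈ A)
    (e : Fin ℓ → ℕ) (hmono : Monotone e) (hfree : IsFreeExp (A.erase H) e)
    (d : ℕ) (hd : (d : ℤ) = ((A.erase H).card : ℤ) - ((restrict A H).card : ℤ))
    (hge : e ⟨ℓ - 3, by omega⟩ ≤ d) :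
    IsFree A ∨
      ∃ lev : ℕ,
        (lev : ℤ) = (e ⟨ℓ - 2, by omega⟩ : ℤ) + (e ⟨ℓ - 1, by omega⟩ : ℤ)
          - (A.card : ℤ) + ((restrict A H).card : ℤ) + 1 ∧
        IsSPOG A (fun i => if i.val = ℓ - 2 ∨ i.val = ℓ - 1 then e i + 1 else e i) lev := by
  classical
  obtain ⟨a, v, B, d0, haH, hv, hBh, hB0, projB, hd0, hdiv, hprime⟩ := terao hA hH
  obtain rfl : d0 = d := by omega
  have hcard : (A.erase H).card + 1 = A.card := Finset.card_erase_add_one hH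
  obtain ⟨θ, hθh, ⟨hθD, hθgen⟩, hθind⟩ := hfree
  choose b hb using fun i => hdiv (θ i) (hθD i)
  have ha0 : a ≠ 0 := by rintro rfl; simp at hv
  have hα0 : linPoly a ≠ 0 := linPoly_ne_zero ha0
  have projb : ∀ i, proj a v (b i) = b i := by
    intro i
    apply mul_left_cancel₀ hB0
    have h2 := proj_proj hv (applyLin (θ i) a)
    rw [hb i, map_mul, projB] at h2
    exact h2
  have hbh : ∀ i, b i ≠ 0 → d0 ≤ e i ∧ (b i).IsHomogeneous (e i - d0) := by
    intro i hi
    refine cofactor_hom hBh hB0 ?_ hi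
    rw [← hb i]
    exact proj_hom a v (applyLin_hom (hθh i) a)
  have mem : ∀ c : Fin ℓ → MvPolynomial (Fin ℓ) K,
      InD A (∑ i, c i • θ i) ↔ ∑ i, proj a v (c i) * b i = 0 := by
    intro c
    rw [inD_iff hH haH, applyLin_sum, ← proj_eq_zero_iff hv, map_sum]
    have : ∑ i, proj a v (c i * applyLin (θ i) a) = B * ∑ i, proj a v (c i) * b i := by
      rw [Finset.mul_sum]
      exact Finset.sum_congr rfl fun i _ => by rw [map_mul, hb i]; ring
    rw [this, mul_eq_zero, or_iff_right hB0]
    refine and_iff_right ?_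
    exact (Dmod (A.erase H)).sum_mem fun i _ => (Dmod (A.erase H)).smul_mem _ (hθD i)
  have genA : ∀ η, InD A η → ∃ c : Fin ℓ → MvPolynomial (Fin ℓ) K, η = ∑ i, c i • θ i ∧
      ∑ i, proj a v (c i) * b i = 0 := by
    intro η hη
    obtain ⟨c, rfl⟩ := hθgen η ((inD_iff hH haH).mp hη).1
    exact ⟨c, rfl, (mem c).mp hη⟩
  -- the divisible case
  have free_of : ∀ (n : Fin ℓ) (q : Fin ℓ → MvPolynomial (Fin ℓ) K), b n ≠ 0 → q n = 0 →
      (∀ j, j ≠ n → b j = q j * b n) → (∀ j, proj a v (q j) = q j) →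
      (∀ j, q j = 0 ∨ (e n ≤ e j ∧ (q j).IsHomogeneous (e j - e n))) → IsFree A := by
    intro n q hbn hqn hbq projq hqh
    set u : Fin ℓ → MvPolynomial (Fin ℓ) K := fun j => if j = n then linPoly a else 1 with hu
    have expand : ∀ c : Fin ℓ → MvPolynomial (Fin ℓ) K,
        ∑ j, c j • (u j • θ j - q j • θ n) =
          ∑ j, (c j * u j - (if j = n then ∑ k, c k * q k else 0)) • θ j := by
      intro c
      simp only [smul_sub, sub_smul, Finset.sum_sub_distrib, smul_smul, ite_smul, zero_smul,
        Finset.sum_ite_eq', Finset.mem_univ, if_true, Finset.sum_smul]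
    refine ⟨fun j => if j = n then e j + 1 else e j, fun j => u j • θ j - q j • θ n,
      ?_, ⟨?_, ?_⟩, ?_⟩
    · intro j i
      simp only [Pi.sub_apply, Pi.smul_apply, smul_eq_mul]
      refine IsHomogeneous.sub ?_ ?_
      · simp only [hu]
        split_ifs with h
        · rw [add_comm]; exact (linPoly_hom a).mul (hθh j i)
        · rw [one_mul]; exact hθh j i
      · split_ifs with h
        · rw [h, hqn, zero_mul]; exact isHomogeneous_zero _ _ _
        · rcases hqh j with h0 | ⟨h1, h2⟩
          · rw [h0, zero_mul]; exact isHomogeneous_zero _ _ _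
          · have := h2.mul (hθh n i)
            rwa [Nat.sub_add_cancel h1] at this
    · intro j
      have h1 := expand (Pi.single j 1)
      rw [Finset.sum_eq_single j (by intro i _ hij; simp [hij]) (by simp)] at h1
      rw [Pi.single_eq_same, one_smul] at h1
      change InD A (u j • θ j - q j • θ n)
      rw [h1, mem]
      have h2 : ∑ k, (Pi.single j 1 : Fin ℓ → MvPolynomial (Fin ℓ) K) k * q k = q j := by
        rw [Finset.sum_eq_single j (by intro i _ hij; simp [hij]) (by simp)]; simp
      rw [h2]
      by_cases hjn : j = n
      · subst hjn
        refine Finset.sum_eq_zero fun i _ => ?_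
        by_cases hij : i = j
        · subst hij; simp [hu, hqn, proj_self hv]
        · simp [hij]
      · have h3 : ∀ i, proj a v ((Pi.single j 1 : Fin ℓ → MvPolynomial (Fin ℓ) K) i * u i
            - if i = n then q j else 0) * b i
            = (if i = j then b j else 0) - (if i = n then q j * b n else 0) := by
          intro i
          by_cases hij : i = j
          · subst hij; simp [hjn, hu]
          · by_cases hin : i = n
            · subst hin; simp [hij, projq]
            · simp [hij, hin]
        simp only [h3, Finset.sum_sub_distrib, Finset.sum_ite_eq', Finset.mem_univ, if_true]
        rw [hbq j hjn, sub_self]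
    · intro η hη
      obtain ⟨c, rfl, hc⟩ := genA η hη
      have h1 : linPoly a ∣ c n + ∑ k, c k * q k := by
        rw [← proj_eq_zero_iff hv]
        apply mul_right_cancel₀ hbn
        rw [zero_mul, ← hc, map_add, map_sum, add_mul, Finset.sum_mul]
        have h2 : ∀ i, proj a v (c i) * b i = (if i = n then proj a v (c n) * b n else 0)
            + proj a v (c i * q i) * b n := by
          intro i
          by_cases hin : i = n
          · subst hin; simp [hqn]
          · rw [if_neg hin, hbq i hin, map_mul, projq]; ring
        rw [show ∑ i, proj a v (c i) * b i = _ from Finset.sum_congr rfl fun i _ => h2 i]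
        simp only [Finset.sum_add_distrib, Finset.sum_ite_eq', Finset.mem_univ, if_true]
      obtain ⟨t, ht⟩ := h1
      refine ⟨Function.update c n t, ?_⟩
      rw [expand]
      refine Finset.sum_congr rfl fun j _ => ?_
      have h3 : ∑ k, Function.update c n t k * q k = ∑ k, c k * q k := by
        refine Finset.sum_congr rfl fun k _ => ?_
        by_cases hkn : k = n
        · subst hkn; simp [hqn]
        · simp [hkn]
      rw [h3]
      by_cases hjn : j = n
      · subst hjn
        simp only [hu, Function.update_self, if_true]
        congr 1
        linear_combination ht
      · simp [hjn, hu]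
    · intro c hc
      change ∑ j, c j • (u j • θ j - q j • θ n) = 0 at hc
      rw [expand] at hc
      have h1 := hθind _ hc
      have h2 : ∀ j, j ≠ n → c j = 0 := by
        intro j hj
        have := h1 j
        simpa [hj, hu] using this
      have h3 : ∑ k, c k * q k = 0 := by
        refine Finset.sum_eq_zero fun k _ => ?_
        by_cases hkn : k = n
        · rw [hkn, hqn, mul_zero]
        · rw [h2 k hkn, zero_mul]
      intro j
      by_cases hj : j = n
      · have := h1 j
        simp only [h3, hj, hu, if_true, sub_zero, mul_eq_zero, hα0, or_false] at this
        rw [hj]; exact this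
      · exact h2 j hj
  by_cases h1 : ∃ n, b n ≠ 0 ∧ e n = d0
  · left
    obtain ⟨n, hbn, hen⟩ := h1
    obtain ⟨u, hu⟩ : ∃ u, b n = C u := by
      have h2 := (hbh n hbn).2
      rw [hen, Nat.sub_self] at h2
      exact ⟨_, totalDegree_eq_zero_iff_eq_C.mp (Nat.le_zero.mp h2.totalDegree_le)⟩
    have hu0 : u ≠ 0 := by rintro rfl; simp at hu; exact hbn hu
    refine free_of n (fun j => if j = n then 0 else C u⁻¹ * b j) hbn (by simp) ?_ ?_ ?_
    · intro j hj
      simp only [hj, if_false]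
      rw [hu, mul_right_comm, ← map_mul, inv_mul_cancel₀ hu0, map_one, one_mul]
    · intro j
      split_ifs
      · simp
      · rw [map_mul, proj_C, projb]
    · intro j
      split_ifs with hj
      · left; trivial
      · by_cases hbj : b j = 0
        · left; rw [hbj, mul_zero]
        · right
          rw [hen]
          exact ⟨(hbh j hbj).1, (hbh j hbj).2.C_mul _⟩
  have hlt : ∀ n, b n ≠ 0 → d0 < e n := by
    intro n hn
    refine lt_of_le_of_ne (hbh n hn).1 fun h => h1 ⟨n, hn, h.symm⟩
  obtain ⟨p, hp⟩ : ∃ p : Fin ℓ, p = ⟨ℓ - 2, by omega⟩ := ⟨_, rfl⟩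
  obtain ⟨r, hr⟩ : ∃ r : Fin ℓ, r = ⟨ℓ - 1, by omega⟩ := ⟨_, rfl⟩
  have hpv : p.val = ℓ - 2 := by rw [hp]
  have hrv : r.val = ℓ - 1 := by rw [hr]
  have hpr : p ≠ r := by intro h; rw [h] at hpv; omega
  have hlow : ∀ i, i ≠ p → i ≠ r → b i = 0 := by
    intro i hip hir
    by_contra hbi
    have h2 := hlt i hbi
    have h3 : e i ≤ e ⟨ℓ - 3, by omega⟩ := by
      apply hmono
      rw [Fin.le_def]
      have h4 : i.val ≠ ℓ - 2 := fun h => hip (Fin.ext (by omega))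
      have h5 : i.val ≠ ℓ - 1 := fun h => hir (Fin.ext (by omega))
      have := i.isLt
      simp only
      omega
    omega
  by_cases hbp : b p = 0
  · left
    by_cases hbr : b r = 0
    · have hall : ∀ i, b i = 0 := by
        intro i
        by_cases h2 : i = p
        · rw [h2, hbp]
        · by_cases h3 : i = r
          · rw [h3, hbr]
          · exact hlow i h2 h3
      refine ⟨e, θ, hθh, ⟨?_, ?_⟩, hθind⟩
      · intro i
        have := (mem (Pi.single i 1)).mpr (Finset.sum_eq_zero fun j _ => by rw [hall, mul_zero])
        rwa [Finset.sum_eq_single i (by intro j _ hij; simp [hij]) (by simp),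
          Pi.single_eq_same, one_smul] at this
      · intro η hη
        obtain ⟨c, hc, _⟩ := genA η hη
        exact ⟨c, hc⟩
    · refine free_of r (fun _ => 0) hbr rfl ?_ (by simp) (by simp)
      intro j hj
      rw [zero_mul]
      by_cases h2 : j = p
      · rw [h2, hbp]
      · exact hlow j h2 hj
  by_cases hbr : b r = 0
  · left
    refine free_of p (fun _ => 0) hbp rfl ?_ (by simp) (by simp)
    intro j hj
    rw [zero_mul]
    by_cases h2 : j = r
    · rw [h2, hbr]
    · exact hlow j hj h2
  right
  have hep := hlt p hbp
  have her := hlt r hbr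
  have hrel : IsRelPrime (b p) (b r) := by
    refine (UniqueFactorizationMonoid.isRelPrime_iff_no_prime_factors hbp).mpr ?_
    intro g hgp hgr hg
    refine hprime g hg fun η hη => ?_
    obtain ⟨c, rfl⟩ := hθgen η hη
    rw [applyLin_sum, map_sum]
    refine Finset.dvd_sum fun i _ => ?_
    rw [map_mul, hb i]
    refine Dvd.dvd.mul_left (mul_dvd_mul_left _ ?_) _
    by_cases h2 : i = p
    · rw [h2]; exact hgp
    · by_cases h3 : i = r
      · rw [h3]; exact hgr
      · rw [hlow i h2 h3]; exact dvd_zero _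
  rw [← hp, ← hr]
  refine ⟨e p + e r - d0, by omega, ?_⟩
  have hcond : ∀ i : Fin ℓ, (i.val = ℓ - 2 ∨ i.val = ℓ - 1) ↔ (i = p ∨ i = r) := by
    intro i
    rw [Fin.ext_iff, Fin.ext_iff, hpv, hrv]
  set w : Fin ℓ → MvPolynomial (Fin ℓ) K := fun i => if i = p ∨ i = r then linPoly a else 1 with hw
  set s : Fin ℓ → MvPolynomial (Fin ℓ) K := fun i => if i = p then - b r else
    if i = r then b p else 0 with hs
  have sp : s p = - b r := by simp [hs]
  have sr : s r = b p := by simp [hs, hpr.symm]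
  have s0 : ∀ i, i ≠ p → i ≠ r → s i = 0 := fun i h2 h3 => by simp [hs, h2, h3]
  have wp : w p = linPoly a := by simp [hw]
  have wr : w r = linPoly a := by simp [hw]
  have w0 : ∀ i, i ≠ p → i ≠ r → w i = 1 := fun i h2 h3 => by simp [hw, h2, h3]
  have two : ∀ F : Fin ℓ → MvPolynomial (Fin ℓ) K, (∀ i, i ≠ p → i ≠ r → F i = 0) →
      ∑ i, F i = F p + F r := by
    intro F hF
    exact Fintype.sum_eq_add p r hpr fun i hi => hF i hi.1 hi.2
  have expand : ∀ (g : Fin ℓ → MvPolynomial (Fin ℓ) K) (h : MvPolynomial (Fin ℓ) K),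
      ∑ i, g i • (w i • θ i) + h • ∑ i, s i • θ i = ∑ i, (g i * w i + h * s i) • θ i := by
    intro g h
    simp only [Finset.smul_sum, add_smul, Finset.sum_add_distrib, smul_smul]
  refine ⟨fun i => w i • θ i, ∑ i, s i • θ i, fun i => - s i, linPoly a, ⟨?_, ?_, ?_, ?_, ?_,
    linPoly_hom a, ?_, ?_, ?_, fun h => hα0 h.1, ?_⟩, hα0⟩
  · intro i
    have h2 := (mem (Pi.single i (w i))).mpr (by
      rw [Finset.sum_eq_single i (by intro j _ hij; simp [hij]) (by simp), Pi.single_eq_same]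
      by_cases h2 : i = p
      · rw [h2, wp, proj_self hv, zero_mul]
      · by_cases h3 : i = r
        · rw [h3, wr, proj_self hv, zero_mul]
        · rw [hlow i h2 h3, mul_zero])
    rwa [Finset.sum_eq_single i (by intro j _ hij; simp [hij]) (by simp),
          Pi.single_eq_same] at h2
  · rw [mem, two _ (fun i h2 h3 => by rw [hlow i h2 h3, mul_zero]), sp, sr, map_neg, projb, projb]
    ring
  · intro i j
    simp only [Pi.smul_apply, smul_eq_mul, hcond, hw]
    split_ifs with h
    · rw [add_comm]; exact (linPoly_hom a).mul (hθh i j)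
    · rw [one_mul]; exact hθh i j
  · intro j
    rw [Finset.sum_apply]
    refine IsHomogeneous.sum _ _ _ fun i _ => ?_
    rw [Pi.smul_apply, smul_eq_mul]
    by_cases h2 : i = p
    · have := (hbh r hbr).2.neg.mul (hθh p j)
      rw [h2, sp]
      rwa [show e r - d0 + e p = e p + e r - d0 by omega] at this
    · by_cases h3 : i = r
      · have := (hbh p hbp).2.mul (hθh r j)
        rw [h3, sr]
        rwa [show e p - d0 + e r = e p + e r - d0 by omega] at this
      · rw [s0 i h2 h3, zero_mul]; exact isHomogeneous_zero _ _ _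
  · intro η hη
    obtain ⟨c, rfl, hc⟩ := genA η hη
    rw [two _ (fun i h2 h3 => by rw [hlow i h2 h3, mul_zero])] at hc
    have h2 : b p ∣ proj a v (c r) := by
      apply hrel.dvd_of_dvd_mul_right
      exact ⟨- proj a v (c p), by linear_combination hc⟩
    obtain ⟨t, ht⟩ := h2
    have hcp : proj a v (c p) = - t * b r := by
      apply mul_right_cancel₀ hbp
      rw [ht] at hc
      linear_combination hc
    obtain ⟨x, hx⟩ := dvd_sub_proj a v (c p)
    obtain ⟨y, hy⟩ := dvd_sub_proj a v (c r)
    refine ⟨fun i => if i = p then x else if i = r then y else c i, t, ?_⟩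
    rw [expand]
    refine Finset.sum_congr rfl fun i _ => ?_
    congr 1
    by_cases h2 : i = p
    · subst h2
      rw [if_pos rfl, sp, wp]
      linear_combination hx + hcp
    · by_cases h3 : i = r
      · subst h3
        rw [if_neg h2, if_pos rfl, sr, wr]
        linear_combination hy + ht
      · rw [if_neg h2, if_neg h3, s0 i h2 h3, w0 i h2 h3]
        ring
  · intro i
    beta_reduce
    by_cases h2 : i = p
    · subst h2
      rw [sp, neg_neg, if_pos (Or.inl hpv), show e i + e r - d0 + 1 - (e i + 1) = e r - d0 by omega]
      exact (hbh r hbr).2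
    · by_cases h3 : i = r
      · subst h3
        rw [sr, if_pos (Or.inr hrv), show e p + e i - d0 + 1 - (e i + 1) = e p - d0 by omega]
        exact (hbh p hbp).2.neg
      · rw [s0 i h2 h3, neg_zero]; exact isHomogeneous_zero _ _ _
  · have hcc : ∀ n, b n ≠ 0 → constantCoeff (b n) = 0 := by
      intro n hn
      rw [constantCoeff_eq]
      apply (hbh n hn).2.coeff_eq_zero
      have := hlt n hn
      simp
      omega
    intro i
    rw [map_neg, neg_eq_zero]
    by_cases h2 : i = p
    · rw [h2, sp, map_neg, hcc r hbr, neg_zero]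
    · by_cases h3 : i = r
      · rw [h3, sr, hcc p hbp]
      · rw [s0 i h2 h3, map_zero]
  · rw [expand]
    refine Finset.sum_eq_zero fun i _ => ?_
    have : - s i * w i + linPoly a * s i = 0 := by
      by_cases h2 : i = p
      · rw [h2, wp]; ring
      · by_cases h3 : i = r
        · rw [h3, wr]; ring
        · rw [s0 i h2 h3]; ring
    rw [this, zero_smul]
  · intro g h hgh
    rw [expand] at hgh
    have h2 := hθind _ hgh
    have hαr : linPoly a ∣ h * b r := by
      have := h2 p
      rw [wp, sp] at this
      exact ⟨g p, by linear_combination - this⟩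
    have hαb : ¬ linPoly a ∣ b r := by
      rw [← proj_eq_zero_iff hv, projb]; exact hbr
    have hαh : linPoly a ∣ h := by
      rcases (linPoly_irred ha0).prime.dvd_or_dvd hαr with h3 | h3
      · exact h3
      · exact absurd h3 hαb
    obtain ⟨t, ht⟩ := hαh
    refine ⟨t, ?_, by rw [ht, mul_comm]⟩
    intro i
    beta_reduce
    have h3 := h2 i
    by_cases h4 : i = p ∨ i = r
    · have h5 : w i = linPoly a := by simp [hw, h4]
      apply mul_right_cancel₀ hα0
      rw [h5, ht] at h3
      linear_combination h3
    · push Not at h4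
      rw [s0 i h4.1 h4.2, w0 i h4.1 h4.2] at h3
      rw [s0 i h4.1 h4.2]
      linear_combination h3

end ArrPOG
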